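/- arXiv:2208.01999 — 2 statements merged into one kernel-verified Lean document; each statement's English description precedes it below -/
import Mathlib

section
/- Let R be a commutative ring, p ∈ R, M an R-module, and (Mⁱ)_{i≥0} a descending chain of R-submodules of M with M⁰ = M. Suppose that M^{i+1} = p·Mⁱ + M^{i+2} for every i ≥ 0. Then for all integers 0 ≤ i ≤ n one has Mⁱ = pⁱ·M⁰ + Mⁿ. -/
open Pointwise

/-- In a descending chain with `Mⁱ⁺¹ = p·Mⁱ + Mⁱ⁺²`, the term `Mⁱ⁺²` can be replaced by any `Mⁿ`
with `n ≥ i + 1`. -/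
theorem chain_succ_eq_smul_sup {R M : Type*} [CommRing R] {p : R} [AddCommGroup M] [Module R M]
    {Mc : ℕ → Submodule R M} (hanti : Antitone Mc)
    (hsum : ∀ i : ℕ, Mc (i + 1) = p • Mc i ⊔ Mc (i + 2)) {i n : ℕ} (hn : i + 1 ≤ n) :
    Mc (i + 1) = p • Mc i ⊔ Mc n := by
  have hsmul (j : ℕ) : p • Mc j ≤ Mc (j + 1) := (hsum j).symm ▸ le_sup_left
  refine le_antisymm ?_ (sup_le (hsmul i) (hanti hn))
  induction n, hn using Nat.le_induction with
  | base => exact le_sup_right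
  | succ n hn ih =>
    obtain ⟨k, rfl⟩ : ∃ k, n = k + 1 := ⟨n - 1, by omega⟩
    refine ih.trans (sup_le le_sup_left ?_)
    rw [hsum k]
    exact sup_le_sup_right (smul_mono_right p (hanti (by omega))) _

/-- Let `R` be a commutative ring, `p ∈ R`, `M` an `R`-module and
`(Mⁱ)_{i≥0}` a descending chain of submodules of `M` with `M⁰ = M`, such that
`M^{i+1} = p·Mⁱ + M^{i+2}` for all `i ≥ 0`.  Then `Mⁱ = pⁱ·M⁰ + Mⁿ` for all `0 ≤ i ≤ n`. -/
theorem chain_sum_identity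
    (R : Type*) [CommRing R] (p : R)
    (M : Type*) [AddCommGroup M] [Module R M]
    (Mc : ℕ → Submodule R M)
    (hM0 : Mc 0 = ⊤)
    (hdesc : ∀ i : ℕ, Mc (i + 1) ≤ Mc i)
    (hsum : ∀ i : ℕ, Mc (i + 1) = p • Mc i ⊔ Mc (i + 2)) :
    ∀ i n : ℕ, i ≤ n → Mc i = p ^ i • Mc 0 ⊔ Mc n := by
  have hanti : Antitone Mc := antitone_nat_of_succ_le hdesc
  have hsmul (j : ℕ) : p • Mc j ≤ Mc (j + 1) := (hsum j).symm ▸ le_sup_left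
  intro i
  induction i with
  | zero =>
    intro n _
    rw [pow_zero, one_smul, hM0, top_sup_eq]
  | succ i ih =>
    intro n hn
    obtain ⟨k, rfl⟩ : ∃ k, n = k + 1 := ⟨n - 1, by omega⟩
    rw [chain_succ_eq_smul_sup hanti hsum hn, ih k (by omega), Submodule.smul_sup', smul_smul,
      ← pow_succ', sup_assoc, sup_eq_right.mpr (hsmul k)]
end

section
/- Let R be a commutative ring, p ∈ R, M an R-module on which multiplication by p is injective, and (Mⁱ)_{i≥0} a descending chain of R-submodules of M with M⁰ = M. Suppose that for every i ≥ 0 both M^{i+1} = p·Mⁱ + M^{i+2} and p·M^{i+1} = (p·Mⁱ) ∩ M^{i+2} hold. Then for every integer n ≥ 1, multiplication by p induces an isomorphism of R-modules M⁰/M^{n-1} ≅ M¹/Mⁿ. -/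
open Pointwise

section SmulFiltration

variable {R M : Type*} [CommRing R] [AddCommGroup M] [Module R M] {p : R} {F : ℕ → Submodule R M}

theorem smul_mem_succ_of_eq_sup (hsum : ∀ i, F (i + 1) = p • F i ⊔ F (i + 2)) {i : ℕ} {x : M}
    (hx : x ∈ F i) : p • x ∈ F (i + 1) := by
  rw [hsum]
  exact Submodule.mem_sup_left (Submodule.smul_mem_pointwise_smul x p _ hx)

theorem le_smul_sup_of_eq_sup (hF : Antitone F) (hsum : ∀ i, F (i + 1) = p • F i ⊔ F (i + 2))
    (i k : ℕ) : F (i + 1) ≤ p • F i ⊔ F (i + k + 1) := by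
  induction k with
  | zero => exact le_sup_right
  | succ k ih =>
    refine ih.trans (sup_le le_sup_left ?_)
    rw [hsum (i + k)]
    exact sup_le_sup_right (Submodule.map_mono (hF (Nat.le_add_right i k))) _

theorem mem_of_smul_mem_succ (hp : Function.Injective (fun x : M => p • x)) (hF : Antitone F)
    (hF0 : F 0 = ⊤) (hint : ∀ i, p • F (i + 1) = p • F i ⊓ F (i + 2)) {x : M} {k : ℕ}
    (hx : p • x ∈ F (k + 1)) : x ∈ F k := by
  induction k with
  | zero => simp [hF0]
  | succ k ih =>
    have hpx : p • x ∈ p • F (k + 1) := by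
      rw [hint]
      exact ⟨Submodule.smul_mem_pointwise_smul x p _ (ih (hF (Nat.le_succ _) hx)), hx⟩
    obtain ⟨y, hy, hyx⟩ := (Submodule.mem_smul_pointwise_iff_exists _ _ _).1 hpx
    exact hp hyx ▸ hy

end SmulFiltration

/-- Let `R` be a commutative ring, `p ∈ R`, `M` an `R`-module on which
multiplication by `p` is injective, and `(Mⁱ)_{i≥0}` a descending chain of submodules with
`M⁰ = M` satisfying `M^{i+1} = p·Mⁱ + M^{i+2}` and `p·M^{i+1} = (p·Mⁱ) ∩ M^{i+2}` for all
`i ≥ 0`.  Then for every `n ≥ 1` multiplication by `p` induces an isomorphism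
`M⁰/M^{n-1} ≅ M¹/Mⁿ`. -/
theorem mul_by_p_induces_iso
    (R : Type*) [CommRing R] (p : R)
    (M : Type*) [AddCommGroup M] [Module R M]
    (hp : Function.Injective (fun x : M => p • x))
    (Mc : ℕ → Submodule R M)
    (hM0 : Mc 0 = ⊤)
    (hdesc : ∀ i : ℕ, Mc (i + 1) ≤ Mc i)
    (hsum : ∀ i : ℕ, Mc (i + 1) = p • Mc i ⊔ Mc (i + 2))
    (hint : ∀ i : ℕ, p • Mc (i + 1) = (p • Mc i) ⊓ Mc (i + 2)) :
    ∀ n : ℕ, 1 ≤ n →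
      ∃ e : (M ⧸ Mc (n - 1)) ≃ₗ[R]
          ((Mc 1) ⧸ (Submodule.comap (Mc 1).subtype (Mc n))),
        ∀ (x : M) (hx : p • x ∈ Mc 1),
          e (Submodule.Quotient.mk x) = Submodule.Quotient.mk ⟨p • x, hx⟩ := by
  intro n hn
  obtain ⟨k, rfl⟩ := Nat.exists_eq_add_of_le' hn
  have hF : Antitone Mc := antitone_nat_of_succ_le hdesc
  have hmem (x : M) : p • x ∈ Mc 1 := smul_mem_succ_of_eq_sup hsum (hM0 ▸ Submodule.mem_top)
  let f : M →ₗ[R] Mc 1 := (LinearMap.lsmul R M p).codRestrict (Mc 1) hmem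
  let N := (Mc (k + 1)).comap (Mc 1).subtype
  have hle : Mc k ≤ N.comap f := fun x hx => smul_mem_succ_of_eq_sup hsum hx
  have hinj : Function.Injective ((Mc k).mapQ N f hle) := by
    refine (injective_iff_map_eq_zero _).2 fun q => ?_
    induction q using Submodule.Quotient.induction_on with
    | _ x =>
      intro hx
      rw [Submodule.mapQ_apply, Submodule.Quotient.mk_eq_zero] at hx
      exact (Submodule.Quotient.mk_eq_zero _).2 (mem_of_smul_mem_succ hp hF hM0 hint hx)
  have hsurj : Function.Surjective ((Mc k).mapQ N f hle) := by
    intro q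
    induction q using Submodule.Quotient.induction_on with
    | _ y =>
      obtain ⟨a, ha, z, hz, hy⟩ := Submodule.mem_sup.1 (le_smul_sup_of_eq_sup hF hsum 0 k y.2)
      obtain ⟨x, -, rfl⟩ := (Submodule.mem_smul_pointwise_iff_exists _ _ _).1 ha
      refine ⟨Submodule.Quotient.mk x, ?_⟩
      rw [Submodule.mapQ_apply, Submodule.Quotient.eq]
      change p • x - (y : M) ∈ Mc (k + 1)
      rw [← hy, sub_add_cancel_left]
      rw [zero_add] at hz
      exact neg_mem hz
  exact ⟨LinearEquiv.ofBijective _ ⟨hinj, hsurj⟩, fun _ _ => rfl⟩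
end
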